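/- Let S = K[x_1,…,x_n] be a standard graded polynomial ring over a field K and I ⊂ S a proper nonzero graded ideal all of whose associated primes are generated by linear forms (for example, I a monomial ideal). Then for every associated prime p of I one has v_p(I) ≥ v(I) ≥ α(I) − 1. -/

import Mathlib

open MvPolynomial

/-- A graded (homogeneous) ideal: one generated by homogeneous polynomials. -/
def IsHomogeneousIdeal {K : Type*} [Field K] {n : ℕ}
    (I : Ideal (MvPolynomial (Fin n) K)) : Prop :=
  ∃ G : Set (MvPolynomial (Fin n) K),
    (∀ f ∈ G, ∃ d, f.IsHomogeneous d) ∧ I = Ideal.span G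

/-- `Ass(I)`: the associated primes of `S/I`. -/
def Ass {K : Type*} [Field K] {n : ℕ} (I : Ideal (MvPolynomial (Fin n) K)) :
    Set (Ideal (MvPolynomial (Fin n) K)) :=
  associatedPrimes (MvPolynomial (Fin n) K) (MvPolynomial (Fin n) K ⧸ I)

/-- The local v-number `v_p(I)`. -/
noncomputable def vNumberAt {K : Type*} [Field K] {n : ℕ}
    (I p : Ideal (MvPolynomial (Fin n) K)) : ℕ :=
  sInf {d | ∃ f : MvPolynomial (Fin n) K, f.IsHomogeneous d ∧
    I.colon (Ideal.span {f}) = p}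

/-- The v-number `v(I)`. -/
noncomputable def vNumber {K : Type*} [Field K] {n : ℕ}
    (I : Ideal (MvPolynomial (Fin n) K)) : ℕ :=
  sInf {d | ∃ f : MvPolynomial (Fin n) K, ∃ p ∈ Ass I, f.IsHomogeneous d ∧
    I.colon (Ideal.span {f}) = p}

/-- `α(J)`: the least degree of a nonzero element of `J`. -/
noncomputable def alphaNum {K : Type*} [Field K] {n : ℕ}
    (J : Ideal (MvPolynomial (Fin n) K)) : ℕ :=
  sInf {d | ∃ f ∈ J, f ≠ 0 ∧ f.totalDegree = d}

/-- `c(I) = max{α(p) : p ∈ Ass(I)}`. -/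
noncomputable def cNum {K : Type*} [Field K] {n : ℕ}
    (I : Ideal (MvPolynomial (Fin n) K)) : ℕ :=
  sSup (alphaNum '' Ass I)

attribute [local instance] MvPolynomial.gradedAlgebra

lemma aux_exists {K : Type*} [Field K] {n : ℕ}
    (I : Ideal (MvPolynomial (Fin n) K)) (hhom : IsHomogeneousIdeal I)
    (p : Ideal (MvPolynomial (Fin n) K)) (hp : p ∈ Ass I)
    (hG : ∃ G : Set (MvPolynomial (Fin n) K),
      (∀ f ∈ G, f.IsHomogeneous 1) ∧ p = Ideal.span G) :
    ∃ d, ∃ f : MvPolynomial (Fin n) K, f.IsHomogeneous d ∧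
      I.colon (Ideal.span {f}) = p := by
  have hI : I.IsHomogeneous (homogeneousSubmodule (Fin n) K) := by
    obtain ⟨G, h1, rfl⟩ := hhom
    exact Ideal.homogeneous_span _ _ fun x hx => h1 x hx
  obtain ⟨hprime, x, hx⟩ := isAssociatedPrime_iff.mp hp
  obtain ⟨g, rfl⟩ := Ideal.Quotient.mk_surjective x
  have hmem : ∀ a, a ∈ p ↔ a * g ∈ I := by
    intro a
    rw [hx, Submodule.mem_colon_singleton, Submodule.mem_bot, ← Ideal.Quotient.eq_zero_iff_mem,
      map_mul]
    rfl
  obtain ⟨G, hG1, hG2⟩ := hG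
  have hle : (Finset.range (g.totalDegree + 1)).inf
      (fun i => I.colon (Ideal.span {homogeneousComponent i g})) ≤ p := by
    intro a ha
    rw [Submodule.mem_finsetInf] at ha
    rw [hmem, ← sum_homogeneousComponent g, Finset.mul_sum]
    exact Ideal.sum_mem _ fun i hi => Ideal.mem_colon_span_singleton.mp (ha i hi)
  obtain ⟨i, hi, hip⟩ := hprime.inf_le'.mp hle
  refine ⟨i, homogeneousComponent i g, homogeneousComponent_isHomogeneous i g,
    le_antisymm hip ?_⟩
  rw [hG2, Ideal.span_le]
  intro l hl
  have hlp : l * g ∈ I := (hmem l).mp (hG2 ▸ Ideal.subset_span hl)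
  have h2 := (mem_iff_homogeneousComponent_mem hI _).mp hlp (1 + i)
  have h3 : homogeneousComponent (1 + i) (l * g) = l * homogeneousComponent i g := by
    conv_lhs => rw [← sum_homogeneousComponent g, Finset.mul_sum, map_sum]
    rw [Finset.sum_eq_single_of_mem i hi]
    · rw [homogeneousComponent_of_mem
        ((hG1 l hl).mul (homogeneousComponent_isHomogeneous i g)), if_pos rfl]
    · intro j _ hj
      rw [homogeneousComponent_of_mem
        ((hG1 l hl).mul (homogeneousComponent_isHomogeneous j g)), if_neg (by omega)]
  rw [h3] at h2
  exact Ideal.mem_colon_span_singleton.mpr h2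

/-- If all associated primes of a proper nonzero graded ideal `I` are
generated by linear forms, then `v_p(I) ≥ v(I) ≥ α(I) − 1` for all `p ∈ Ass(I)`. -/
theorem stmt2 {K : Type*} [Field K] {n : ℕ}
    (I : Ideal (MvPolynomial (Fin n) K))
    (hhom : IsHomogeneousIdeal I) (hproper : I ≠ ⊤) (hne : I ≠ ⊥)
    (hlin : ∀ p ∈ Ass I, ∃ G : Set (MvPolynomial (Fin n) K),
      (∀ f ∈ G, f.IsHomogeneous 1) ∧ p = Ideal.span G) :
    ∀ p ∈ Ass I, (vNumber I : ℤ) ≤ (vNumberAt I p : ℤ) ∧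
      (alphaNum I : ℤ) - 1 ≤ (vNumber I : ℤ) := by
  intro p hp
  obtain ⟨d, f, hf, hfp⟩ := aux_exists I hhom p hp (hlin p hp)
  constructor
  · have hm : vNumberAt I p ∈ {d | ∃ f : MvPolynomial (Fin n) K, f.IsHomogeneous d ∧
        I.colon (Ideal.span {f}) = p} := Nat.sInf_mem ⟨d, f, hf, hfp⟩
    obtain ⟨f', h1, h2⟩ := hm
    have : vNumber I ≤ vNumberAt I p := Nat.sInf_le ⟨f', p, hp, h1, h2⟩
    exact_mod_cast this
  · have hm : vNumber I ∈ {d | ∃ f : MvPolynomial (Fin n) K, ∃ p ∈ Ass I, f.IsHomogeneous d ∧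
        I.colon (Ideal.span {f}) = p} := Nat.sInf_mem ⟨d, f, p, hp, hf, hfp⟩
    obtain ⟨f', q, hq, h1, h2⟩ := hm
    obtain ⟨G, hG1, hG2⟩ := hlin q hq
    have hqp : q.IsPrime := hq.1
    have hf0 : f' ≠ 0 := by
      rintro rfl
      apply hqp.ne_top
      rw [← h2, Ideal.eq_top_iff_one, Ideal.mem_colon_span_singleton]
      simp
    have hq0 : ∃ l ∈ G, l ≠ 0 := by
      by_contra! hc
      apply hne
      rw [eq_bot_iff]
      have hb : q ≤ ⊥ := by
        rw [hG2, Ideal.span_le]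
        intro l hl
        simp [hc l hl]
      refine le_trans ?_ hb
      rw [← h2]
      exact Ideal.le_colon
    obtain ⟨l, hl, hl0⟩ := hq0
    have hlf : l * f' ∈ I := by
      rw [← Ideal.mem_colon_span_singleton, h2, hG2]
      exact Ideal.subset_span hl
    have hne0 := mul_ne_zero hl0 hf0
    have : alphaNum I ≤ 1 + vNumber I :=
      Nat.sInf_le ⟨l * f', hlf, hne0, ((hG1 l hl).mul h1).totalDegree hne0⟩
    omega
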